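/- Let K be a field, H a Hopf algebra over K, t > 0, and u ∈ M_t(H) a multiplicative matrix. Assume that for every k ≥ 1 the left H-comodule U_l^{⊗k} is simple with endomorphism algebra reduced to the scalar multiples of the identity, and that U_l^{⊗k} and U_l^{⊗l} are non-isomorphic comodules whenever k ≠ l. Then for all positive integers m, n, the algebra morphism θ : A(m,n) → A(m,t) ⊗ A(t,n), θ(x_{ij}) = Σ_{k=1}^t y_{ik} ⊗ z_{kj}, is injective and its image is exactly the coinvariant algebra (A(m,t) ⊗ A(t,n))^{coH}; hence θ induces a K-algebra isomorphism A(m,n) ≅ (A(m,t) ⊗ A(t,n))^{coH}. -/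

import Mathlib

open TensorProduct

universe u v

variable (K : Type u) [Field K] (H : Type v) [Ring H] [HopfAlgebra K H]

/-- The tensor product coaction on `A ⊗ B`:
`a ⊗ b ↦ Σ a₍₋₁₎ b₍₋₁₎ ⊗ a₍₀₎ ⊗ b₍₀₎`. -/
noncomputable def tensorCoaction {A B : Type*} [AddCommGroup A] [Module K A]
    [AddCommGroup B] [Module K B]
    (βA : A →ₗ[K] H ⊗[K] A) (βB : B →ₗ[K] H ⊗[K] B) :
    A ⊗[K] B →ₗ[K] H ⊗[K] (A ⊗[K] B) :=
  TensorProduct.map (LinearMap.mul' K H) LinearMap.id ∘ₗ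
    (TensorProduct.tensorTensorTensorComm K H A H B).toLinearMap ∘ₗ
      TensorProduct.map βA βB

/-- A (not necessarily coassociative) left `H`-comodule : a `K`-vector space
equipped with a coaction `β : V → H ⊗ V`. -/
structure Comod where
  carrier : Type u
  [grp : AddCommGroup carrier]
  [mod : Module K carrier]
  coaction : carrier →ₗ[K] H ⊗[K] carrier

attribute [instance] Comod.grp Comod.mod

namespace Comod

variable {K H}

/-- The trivial comodule `K`, with coaction `x ↦ 1 ⊗ x`. -/
noncomputable def trivial : Comod K H where
  carrier := K
  coaction := TensorProduct.mk K H K 1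

/-- Tensor product of comodules. -/
noncomputable def tensor (M N : Comod K H) : Comod K H where
  carrier := M.carrier ⊗[K] N.carrier
  coaction := tensorCoaction K H M.coaction N.coaction

/-- `k`-th tensor power of a comodule. -/
noncomputable def pow (M : Comod K H) : ℕ → Comod K H
  | 0 => trivial
  | k + 1 => (pow M k).tensor M

/-- Direct sum of `m` copies of a comodule. -/
noncomputable def pi (m : ℕ) (M : Comod K H) : Comod K H where
  carrier := Fin m → M.carrier
  coaction :=
    ∑ i : Fin m,
      LinearMap.lTensor H (LinearMap.single K (fun _ : Fin m => M.carrier) i) ∘ₗ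
        M.coaction ∘ₗ LinearMap.proj i

/-- Morphisms of comodules: `K`-linear maps `f` with `(1_H ⊗ f) ∘ β_M = β_N ∘ f`. -/
def Hom (M N : Comod K H) (f : M.carrier →ₗ[K] N.carrier) : Prop :=
  LinearMap.lTensor H f ∘ₗ M.coaction = N.coaction ∘ₗ f

/-- A comodule is simple if it is nonzero and its only subcomodules are `0` and itself. -/
def IsSimple (M : Comod K H) : Prop :=
  (∃ x : M.carrier, x ≠ 0) ∧
    ∀ W : Submodule K M.carrier,
      (∀ x ∈ W, M.coaction x ∈ LinearMap.range (LinearMap.lTensor H W.subtype)) →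
        W = ⊥ ∨ W = ⊤

/-- The `K`-vector space of comodule morphisms `M → N`, as a submodule of the
space of linear maps. -/
def homSubmodule (M N : Comod K H) : Submodule K (M.carrier →ₗ[K] N.carrier) where
  carrier := {f | Hom M N f}
  add_mem' {f g} hf hg := by
    simp only [Set.mem_setOf_eq, Hom] at *
    rw [LinearMap.lTensor_add, LinearMap.add_comp, LinearMap.comp_add, hf, hg]
  zero_mem' := by
    simp only [Set.mem_setOf_eq, Hom]
    rw [LinearMap.lTensor_zero, LinearMap.zero_comp, LinearMap.comp_zero]
  smul_mem' c f hf := by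
    simp only [Set.mem_setOf_eq, Hom] at *
    rw [LinearMap.lTensor_smul, LinearMap.smul_comp, LinearMap.comp_smul, hf]

end Comod

/-- The left coaction `ρ' = τ ∘ (id ⊗ S) ∘ ρ` associated to a right coaction `ρ`. -/
noncomputable def leftCoactionOfRight {A : Type*} [AddCommGroup A] [Module K A]
    (ρ : A →ₗ[K] A ⊗[K] H) : A →ₗ[K] H ⊗[K] A :=
  (TensorProduct.comm K A H).toLinearMap ∘ₗ
    LinearMap.lTensor A (HopfAlgebra.antipode (R := K)) ∘ₗ ρ

/-- The coinvariants `{x | β(x) = 1 ⊗ x}` of a left comodule. -/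
def coinvariants {M : Type*} [AddCommGroup M] [Module K M]
    (β : M →ₗ[K] H ⊗[K] M) : Set M :=
  {x : M | β x = (1 : H) ⊗ₜ[K] x}

/-- The comodule `K^t` associated to a matrix `u ∈ M_t(H)`:
the coaction is `β(e_i) = ∑ⱼ u_{ij} ⊗ e_j`. -/
noncomputable def matrixComod (t : ℕ) (u : Matrix (Fin t) (Fin t) H) : Comod K H where
  carrier := Fin t → K
  coaction :=
    (Pi.basisFun K (Fin t)).constr K fun i =>
      ∑ j : Fin t, u i j ⊗ₜ[K] (Pi.single j (1 : K) : Fin t → K)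

section Words

/-- Words of length `k` in the letters `0, …, t - 1`, built by appending letters on the right. -/
def Word (t : ℕ) : ℕ → Type
  | 0 => Unit
  | k + 1 => Word t k × Fin t

namespace Word

instance instFintype (t : ℕ) : (k : ℕ) → Fintype (Word t k)
  | 0 => inferInstanceAs (Fintype Unit)
  | k + 1 =>
    letI := instFintype t k
    inferInstanceAs (Fintype (Word t k × Fin t))

instance instDecidableEq (t : ℕ) : (k : ℕ) → DecidableEq (Word t k)
  | 0 => inferInstanceAs (DecidableEq Unit)
  | k + 1 =>
    letI := instDecidableEq t k
    inferInstanceAs (DecidableEq (Word t k × Fin t))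

instance instUnique (t : ℕ) : Unique (Word t 0) := inferInstanceAs (Unique Unit)

/-- The constant word. -/
def const {t : ℕ} (a : Fin t) : (k : ℕ) → Word t k
  | 0 => ()
  | k + 1 => (const a k, a)

theorem sum_succ {t k : ℕ} {M : Type*} [AddCommMonoid M] (f : Word t (k + 1) → M) :
    ∑ I, f I = ∑ I : Word t k, ∑ i : Fin t, f (I, i) :=
  Fintype.sum_prod_type f

/-- The word in pairs of letters obtained by zipping two words of the same length. -/
def zip {a b : ℕ} : {k : ℕ} → Word a k → Word b k → FreeMonoid (Fin a × Fin b)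
  | 0, _, _ => 1
  | _ + 1, I, J => zip I.1 J.1 * FreeMonoid.of (I.2, J.2)

theorem length_zip {a b : ℕ} : {k : ℕ} → (I : Word a k) → (J : Word b k) →
    (zip I J).length = k
  | 0, _, _ => rfl
  | k + 1, I, J => by simp [zip, length_zip I.1 J.1]

theorem zip_injective {a b : ℕ} : {k : ℕ} → {I I' : Word a k} → {J J' : Word b k} →
    zip I J = zip I' J' → I = I' ∧ J = J'
  | 0, _, _, _, _, _ => ⟨rfl, rfl⟩
  | k + 1, (I, i), (I', i'), (J, j), (J', j'), h => by
    have h' := List.append_inj'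
      (show (zip I J).toList ++ [(i, j)] = (zip I' J').toList ++ [(i', j')] from h) rfl
    obtain ⟨rfl, rfl⟩ := zip_injective (FreeMonoid.toList.injective h'.1)
    have h2 := h'.2
    simp only [List.cons.injEq, Prod.mk.injEq, and_true] at h2
    obtain ⟨rfl, rfl⟩ := h2
    exact ⟨rfl, rfl⟩

theorem zip_bijective (a b : ℕ) : Function.Bijective
    (fun w : (Σ k, Word a k × Word b k) => zip w.2.1 w.2.2) := by
  constructor
  · rintro ⟨k, I, J⟩ ⟨l, I', J'⟩ h
    obtain rfl : k = l := by
      rw [← length_zip I J, ← length_zip I' J']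
      exact congrArg FreeMonoid.length h
    obtain ⟨rfl, rfl⟩ := zip_injective h
    rfl
  · intro w
    induction w using List.reverseRecOn with
    | nil => exact ⟨⟨0, (), ()⟩, rfl⟩
    | append_singleton w x ih =>
      obtain ⟨⟨k, I, J⟩, h⟩ := ih
      exact ⟨⟨k + 1, (I, x.1), (J, x.2)⟩, congrArg (· * FreeMonoid.of x) h⟩

end Word

/-- The monomial `x_{i₁ j₁} ⋯ x_{iₖ jₖ}` attached to two words `I` and `J` of length `k`. -/
noncomputable def monomialOfWords {a b : ℕ} :
    {k : ℕ} → Word a k → Word b k → FreeAlgebra K (Fin a × Fin b)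
  | 0, _, _ => 1
  | _ + 1, I, J => monomialOfWords I.1 J.1 * FreeAlgebra.ι K (I.2, J.2)

theorem FreeAlgebra.basisFreeMonoid_apply {X : Type*} (w : FreeMonoid X) :
    FreeAlgebra.basisFreeMonoid K X w = FreeMonoid.lift (FreeAlgebra.ι K) w := by
  change FreeAlgebra.equivMonoidAlgebraFreeMonoid.symm (MonoidAlgebra.single w 1) = _
  simp [FreeAlgebra.equivMonoidAlgebraFreeMonoid]

/-- The monomial basis of the free algebra on `a * b` generators. -/
noncomputable def wordBasis (a b : ℕ) :
    Module.Basis (Σ k, Word a k × Word b k) K (FreeAlgebra K (Fin a × Fin b)) :=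
  (FreeAlgebra.basisFreeMonoid K (Fin a × Fin b)).reindex
    (Equiv.ofBijective _ (Word.zip_bijective a b)).symm

theorem lift_zip {a b : ℕ} : {k : ℕ} → (I : Word a k) → (J : Word b k) →
    FreeMonoid.lift (FreeAlgebra.ι K) (Word.zip I J) = monomialOfWords K I J
  | 0, _, _ => map_one _
  | _ + 1, I, J => by
    simp [Word.zip, monomialOfWords, lift_zip I.1 J.1]

@[simp]
theorem wordBasis_apply {a b k : ℕ} (I : Word a k) (J : Word b k) :
    wordBasis K a b ⟨k, I, J⟩ = monomialOfWords K I J := by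
  simp [wordBasis, FreeAlgebra.basisFreeMonoid_apply, lift_zip]

end Words

section MatrixCoefficients

variable {K H} {t : ℕ}

/-- The matrix coefficients `u_{i₁ j₁} ⋯ u_{iₖ jₖ}` of the tensor powers of `u`. -/
def powCoeff (u : Matrix (Fin t) (Fin t) H) : {k : ℕ} → Word t k → Word t k → H
  | 0, _, _ => 1
  | _ + 1, I, J => powCoeff u I.1 J.1 * u I.2 J.2

theorem comul_powCoeff {u : Matrix (Fin t) (Fin t) H}
    (hu : ∀ i j, Coalgebra.comul (R := K) (u i j) = ∑ k : Fin t, u i k ⊗ₜ[K] u k j) :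
    {k : ℕ} → (I J : Word t k) → Coalgebra.comul (R := K) (powCoeff u I J) =
      ∑ L, powCoeff u I L ⊗ₜ[K] powCoeff u L J
  | 0, I, J => by
    simp [powCoeff, Algebra.TensorProduct.one_def]
  | k + 1, I, J => by
    simp [powCoeff, Word.sum_succ, comul_powCoeff hu I.1 J.1, hu, Finset.sum_mul_sum]

theorem counit_powCoeff {u : Matrix (Fin t) (Fin t) H}
    (hu : ∀ i j, Coalgebra.counit (R := K) (u i j) = if i = j then (1 : K) else 0) :
    {k : ℕ} → (I J : Word t k) → Coalgebra.counit (R := K) (powCoeff u I J) =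
      if I = J then (1 : K) else 0
  | 0, I, J => by
    simp [powCoeff, Subsingleton.elim I J]
  | k + 1, (I, i), (J, j) => by
    have h : ((I, i) : Word t (k + 1)) = (J, j) ↔ I = J ∧ i = j := Prod.mk_inj
    refine Eq.trans ?_ (if_congr h rfl rfl).symm
    by_cases hi : i = j <;> simp [powCoeff, counit_powCoeff hu I J, hu, hi]

variable {u : Matrix (Fin t) (Fin t) H}

theorem sum_antipode_mul_powCoeff
    (hu_comul : ∀ i j, Coalgebra.comul (R := K) (u i j) = ∑ k : Fin t, u i k ⊗ₜ[K] u k j)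
    (hu_counit : ∀ i j, Coalgebra.counit (R := K) (u i j) = if i = j then (1 : K) else 0)
    {k : ℕ} (I J : Word t k) :
    ∑ L, HopfAlgebra.antipode K (powCoeff u I L) * powCoeff u L J = if I = J then 1 else 0 := by
  have h := HopfAlgebra.mul_antipode_rTensor_comul_apply (R := K) (powCoeff u I J)
  simpa [comul_powCoeff hu_comul, counit_powCoeff hu_counit, apply_ite] using h

theorem sum_mul_antipode_powCoeff
    (hu_comul : ∀ i j, Coalgebra.comul (R := K) (u i j) = ∑ k : Fin t, u i k ⊗ₜ[K] u k j)
    (hu_counit : ∀ i j, Coalgebra.counit (R := K) (u i j) = if i = j then (1 : K) else 0)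
    {k : ℕ} (I J : Word t k) :
    ∑ L, powCoeff u I L * HopfAlgebra.antipode K (powCoeff u L J) = if I = J then 1 else 0 := by
  have h := HopfAlgebra.mul_antipode_lTensor_comul_apply (R := K) (powCoeff u I J)
  simpa [comul_powCoeff hu_comul, counit_powCoeff hu_counit, apply_ite] using h

end MatrixCoefficients

section TensorPowers

variable {K H} {t : ℕ}

theorem tensorCoaction_tmul {A B ι κ : Type*} [Fintype ι] [Fintype κ]
    [AddCommGroup A] [Module K A] [AddCommGroup B] [Module K B]
    {βA : A →ₗ[K] H ⊗[K] A} {βB : B →ₗ[K] H ⊗[K] B} {a : A} {b : B}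
    {g : ι → H} {a' : ι → A} {h : κ → H} {b' : κ → B}
    (ha : βA a = ∑ i, g i ⊗ₜ[K] a' i) (hb : βB b = ∑ j, h j ⊗ₜ[K] b' j) :
    tensorCoaction K H βA βB (a ⊗ₜ[K] b) =
      ∑ i, ∑ j, (g i * h j) ⊗ₜ[K] (a' i ⊗ₜ[K] b' j) := by
  simp only [tensorCoaction, LinearMap.comp_apply, TensorProduct.map_tmul, ha, hb,
    TensorProduct.sum_tmul, TensorProduct.tmul_sum, map_sum, LinearEquiv.coe_coe,
    TensorProduct.tensorTensorTensorComm_tmul, LinearMap.mul'_apply, LinearMap.id_apply]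
  exact Finset.sum_comm

variable (K) in
/-- The standard basis of the comodule attached to a matrix. -/
noncomputable def matrixComodBasis (u : Matrix (Fin t) (Fin t) H) :
    Module.Basis (Fin t) K (matrixComod K H t u).carrier :=
  Pi.basisFun K (Fin t)

theorem coaction_matrixComodBasis (u : Matrix (Fin t) (Fin t) H) (i : Fin t) :
    (matrixComod K H t u).coaction (matrixComodBasis K u i) =
      ∑ j, u i j ⊗ₜ[K] matrixComodBasis K u j := by
  have h : (Pi.basisFun K (Fin t)).constr K
      (fun i => ∑ j, u i j ⊗ₜ[K] (Pi.single j (1 : K) : Fin t → K)) (Pi.basisFun K (Fin t) i) =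
        ∑ j, u i j ⊗ₜ[K] Pi.basisFun K (Fin t) j := by
    rw [Module.Basis.constr_basis]
    simp only [Pi.basisFun_apply]
  exact h

variable (K) in
/-- The standard basis of the `k`-th tensor power of the comodule attached to a matrix. -/
noncomputable def powBasis (u : Matrix (Fin t) (Fin t) H) :
    (k : ℕ) → Module.Basis (Word t k) K ((matrixComod K H t u).pow k).carrier
  | 0 => Module.Basis.singleton Unit K
  | k + 1 => (powBasis u k).tensorProduct (matrixComodBasis K u)

theorem coaction_powBasis (u : Matrix (Fin t) (Fin t) H) : (k : ℕ) → (I : Word t k) →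
    ((matrixComod K H t u).pow k).coaction (powBasis K u k I) =
      ∑ J, powCoeff u I J ⊗ₜ[K] powBasis K u k J
  | 0, I => by
    rw [Fintype.sum_unique, Subsingleton.elim I default]
    rfl
  | k + 1, (I, i) => by
    have h (J : Word t k) (j : Fin t) : powBasis K u (k + 1) (J, j) =
        powBasis K u k J ⊗ₜ[K] matrixComodBasis K u j :=
      Module.Basis.tensorProduct_apply _ _ _ _
    rw [Word.sum_succ, h]
    simp only [h]
    exact tensorCoaction_tmul (coaction_powBasis u k I) (coaction_matrixComodBasis u i)

end TensorPowers

namespace Comod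

variable {K H}

theorem Hom.bijective_of_ne_zero {M N : Comod K H} {f : M.carrier →ₗ[K] N.carrier}
    (hf : Hom M N f) (hM : M.IsSimple) (hN : N.IsSimple) (h0 : f ≠ 0) :
    Function.Bijective f := by
  have hf' (x : M.carrier) : LinearMap.lTensor H f (M.coaction x) = N.coaction (f x) :=
    LinearMap.congr_fun hf x
  constructor
  · rw [← LinearMap.ker_eq_bot]
    refine (hM.2 _ fun x hx => ?_).resolve_right fun h => h0 (LinearMap.ker_eq_top.1 h)
    have hexact := Module.Flat.lTensor_exact H f.exact_subtype_ker_map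
    rw [LinearMap.mem_range]
    refine (hexact _).1 ?_
    rw [hf', LinearMap.mem_ker.1 hx, map_zero]
  · rw [← LinearMap.range_eq_top]
    refine (hN.2 _ ?_).resolve_left fun h => h0 (LinearMap.range_eq_bot.1 h)
    rintro _ ⟨x, rfl⟩
    rw [← hf']
    have hcomp : f = (LinearMap.range f).subtype ∘ₗ f.rangeRestrict := rfl
    rw [hcomp, LinearMap.lTensor_comp]
    exact ⟨_, rfl⟩

theorem isSimple_trivial : (trivial : Comod K H).IsSimple :=
  ⟨⟨(1 : K), one_ne_zero (α := K)⟩, fun W _ => eq_bot_or_eq_top (α := Ideal K) W⟩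

theorem Hom.rTensor {M N : Comod K H} (P : Comod K H) {f : M.carrier →ₗ[K] N.carrier}
    (hf : Hom M N f) : Hom (M.tensor P) (N.tensor P) (LinearMap.rTensor P.carrier f) := by
  have hf' (x : M.carrier) : LinearMap.lTensor H f (M.coaction x) = N.coaction (f x) :=
    LinearMap.congr_fun hf x
  refine TensorProduct.ext' fun x y => ?_
  change LinearMap.lTensor H (LinearMap.rTensor P.carrier f)
      (tensorCoaction K H M.coaction P.coaction (x ⊗ₜ[K] y)) =
    tensorCoaction K H N.coaction P.coaction (f x ⊗ₜ[K] y)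
  simp only [tensorCoaction, LinearMap.comp_apply, TensorProduct.map_tmul, ← hf']
  induction M.coaction x with
  | zero => simp
  | add a b ha hb => simp only [TensorProduct.add_tmul, map_add, ha, hb]
  | tmul g m =>
    induction P.coaction y with
    | zero => simp
    | add a b ha hb => simp only [TensorProduct.tmul_add, map_add, ha, hb]
    | tmul h p => simp

variable {M : Comod K H}

theorem isSimple_pow (hsimple : ∀ k : ℕ, 1 ≤ k → (M.pow k).IsSimple) : ∀ k, (M.pow k).IsSimple
  | 0 => isSimple_trivial
  | k + 1 => hsimple (k + 1) k.succ_pos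

theorem Hom.pow_eq_zero (hsimple : ∀ k : ℕ, 1 ≤ k → (M.pow k).IsSimple)
    (hniso : ∀ k l : ℕ, 1 ≤ k → 1 ≤ l → k ≠ l →
      ¬∃ f : (M.pow k).carrier →ₗ[K] (M.pow l).carrier,
        Hom (M.pow k) (M.pow l) f ∧ Function.Bijective f)
    {k l : ℕ} (hkl : k ≠ l) {f : (M.pow k).carrier →ₗ[K] (M.pow l).carrier}
    (hf : Hom (M.pow k) (M.pow l) f) : f = 0 := by
  by_contra h0
  have hbij := hf.bijective_of_ne_zero (isSimple_pow hsimple k) (isSimple_pow hsimple l) h0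
  exact hniso (k + 1) (l + 1) k.succ_pos l.succ_pos (by omega)
    ⟨LinearMap.rTensor M.carrier f, hf.rTensor M,
      (LinearEquiv.rTensor M.carrier (LinearEquiv.ofBijective f hbij)).bijective⟩

theorem Hom.pow_eq_smul_id
    (hend : ∀ k : ℕ, 1 ≤ k → ∀ f : (M.pow k).carrier →ₗ[K] (M.pow k).carrier,
      Hom (M.pow k) (M.pow k) f → ∃ c : K, f = c • LinearMap.id) :
    ∀ {k : ℕ} {f : (M.pow k).carrier →ₗ[K] (M.pow k).carrier},
      Hom (M.pow k) (M.pow k) f → ∃ c : K, f = c • LinearMap.id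
  | 0, f, _ =>
    have h (g : K →ₗ[K] K) : ∃ c : K, g = c • LinearMap.id :=
      ⟨g 1, LinearMap.ext_ring (by simp)⟩
    h f
  | k + 1, f, hf => hend (k + 1) k.succ_pos f hf

end Comod

section Intertwiners

variable {K H} {t : ℕ} {u : Matrix (Fin t) (Fin t) H}

/-- The linear map between tensor powers with a given matrix in the standard bases. -/
noncomputable def powMatrixMap (u : Matrix (Fin t) (Fin t) H) {k l : ℕ}
    (c : Word t k → Word t l → K) :
    ((matrixComod K H t u).pow k).carrier →ₗ[K] ((matrixComod K H t u).pow l).carrier :=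
  (powBasis K u k).constr K fun J => ∑ P, c J P • powBasis K u l P

theorem powMatrixMap_powBasis {k l : ℕ} (c : Word t k → Word t l → K) (J : Word t k) :
    powMatrixMap u c (powBasis K u k J) = ∑ P, c J P • powBasis K u l P :=
  Module.Basis.constr_basis _ _ _ _

theorem repr_powMatrixMap {k l : ℕ} (c : Word t k → Word t l → K) (J : Word t k)
    (P : Word t l) :
    (powBasis K u l).repr (powMatrixMap u c (powBasis K u k J)) P = c J P := by
  rw [powMatrixMap_powBasis, Module.Basis.repr_sum_self]

theorem hom_powMatrixMap {k l : ℕ} {c : Word t k → Word t l → K}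
    (hc : ∀ J R, ∑ P, c J P • powCoeff u P R = ∑ L, c L R • powCoeff u J L) :
    Comod.Hom ((matrixComod K H t u).pow k) ((matrixComod K H t u).pow l)
      (powMatrixMap u c) := by
  refine (powBasis K u k).ext fun J => ?_
  simp only [LinearMap.comp_apply, coaction_powBasis, map_sum, LinearMap.lTensor_tmul,
    powMatrixMap_powBasis, map_smul, TensorProduct.tmul_sum, Finset.smul_sum,
    TensorProduct.tmul_smul, TensorProduct.smul_tmul']
  rw [Finset.sum_comm]
  conv_rhs => rw [Finset.sum_comm]
  simp only [← TensorProduct.sum_tmul, hc]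

end Intertwiners

section Coinvariants

variable {K H} {m n t : ℕ} {u : Matrix (Fin t) (Fin t) H}

/-- The right coaction `x_{ij} ↦ ∑ₖ x_{ik} ⊗ u_{kj}` on a free algebra. -/
noncomputable def rightMatrixCoaction (m : ℕ) (u : Matrix (Fin t) (Fin t) H) :
    FreeAlgebra K (Fin m × Fin t) →ₐ[K] FreeAlgebra K (Fin m × Fin t) ⊗[K] H :=
  FreeAlgebra.lift K fun p : Fin m × Fin t =>
    ∑ k : Fin t, FreeAlgebra.ι K ((p.1, k) : Fin m × Fin t) ⊗ₜ[K] u k p.2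

/-- The left coaction `x_{ij} ↦ ∑ₖ u_{ik} ⊗ x_{kj}` on a free algebra. -/
noncomputable def leftMatrixCoaction (n : ℕ) (u : Matrix (Fin t) (Fin t) H) :
    FreeAlgebra K (Fin t × Fin n) →ₐ[K] H ⊗[K] FreeAlgebra K (Fin t × Fin n) :=
  FreeAlgebra.lift K fun p : Fin t × Fin n =>
    ∑ k : Fin t, u p.1 k ⊗ₜ[K] FreeAlgebra.ι K ((k, p.2) : Fin t × Fin n)

variable (K m n t) in
/-- The matrix comultiplication `x_{ij} ↦ ∑ₖ y_{ik} ⊗ z_{kj}` between free algebras. -/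
noncomputable def matrixComul : FreeAlgebra K (Fin m × Fin n) →ₐ[K]
    FreeAlgebra K (Fin m × Fin t) ⊗[K] FreeAlgebra K (Fin t × Fin n) :=
  FreeAlgebra.lift K fun p : Fin m × Fin n =>
    ∑ k : Fin t,
      FreeAlgebra.ι K ((p.1, k) : Fin m × Fin t) ⊗ₜ[K] FreeAlgebra.ι K ((k, p.2) : Fin t × Fin n)

theorem rightMatrixCoaction_monomial : {k : ℕ} → (I : Word m k) → (J : Word t k) →
    rightMatrixCoaction m u (monomialOfWords K I J) =
      ∑ L, monomialOfWords K I L ⊗ₜ[K] powCoeff u L J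
  | 0, I, J => by
    rw [Fintype.sum_unique]
    exact map_one _
  | k + 1, I, J => by
    have hι : rightMatrixCoaction m u (FreeAlgebra.ι K (I.2, J.2)) = _ :=
      FreeAlgebra.lift_ι_apply _ _
    simp [monomialOfWords, powCoeff, Word.sum_succ, rightMatrixCoaction_monomial I.1 J.1, hι,
      Finset.sum_mul_sum]

theorem leftMatrixCoaction_monomial : {k : ℕ} → (I : Word t k) → (J : Word n k) →
    leftMatrixCoaction n u (monomialOfWords K I J) =
      ∑ L, powCoeff u I L ⊗ₜ[K] monomialOfWords K L J
  | 0, I, J => by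
    rw [Fintype.sum_unique]
    exact map_one _
  | k + 1, I, J => by
    have hι : leftMatrixCoaction n u (FreeAlgebra.ι K (I.2, J.2)) = _ :=
      FreeAlgebra.lift_ι_apply _ _
    simp [monomialOfWords, powCoeff, Word.sum_succ, leftMatrixCoaction_monomial I.1 J.1, hι,
      Finset.sum_mul_sum]

theorem matrixComul_monomial : {k : ℕ} → (I : Word m k) → (J : Word n k) →
    matrixComul K m n t (monomialOfWords K I J) =
      ∑ L, monomialOfWords K I L ⊗ₜ[K] monomialOfWords K L J
  | 0, I, J => by
    rw [Fintype.sum_unique]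
    exact map_one _
  | k + 1, I, J => by
    have hι : matrixComul K m n t (FreeAlgebra.ι K (I.2, J.2)) = _ :=
      FreeAlgebra.lift_ι_apply _ _
    simp [monomialOfWords, Word.sum_succ, matrixComul_monomial I.1 J.1, hι,
      Finset.sum_mul_sum]

variable (K) in
/-- The left coaction on `A(m,t) ⊗ A(t,n)` whose coinvariants are computed. -/
noncomputable def balancedCoaction (m n : ℕ) (u : Matrix (Fin t) (Fin t) H) :
    FreeAlgebra K (Fin m × Fin t) ⊗[K] FreeAlgebra K (Fin t × Fin n) →ₗ[K]
      H ⊗[K] (FreeAlgebra K (Fin m × Fin t) ⊗[K] FreeAlgebra K (Fin t × Fin n)) :=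
  tensorCoaction K H (leftCoactionOfRight K H (rightMatrixCoaction m u).toLinearMap)
    (leftMatrixCoaction n u).toLinearMap

theorem balancedCoaction_monomial {k l : ℕ} (I : Word m k) (J : Word t k) (P : Word t l)
    (Q : Word n l) :
    balancedCoaction K m n u (monomialOfWords K I J ⊗ₜ[K] monomialOfWords K P Q) =
      ∑ L, ∑ R, (HopfAlgebra.antipode K (powCoeff u L J) * powCoeff u P R) ⊗ₜ[K]
        (monomialOfWords K I L ⊗ₜ[K] monomialOfWords K R Q) := by
  refine tensorCoaction_tmul ?_ (leftMatrixCoaction_monomial P Q)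
  simp [leftCoactionOfRight, rightMatrixCoaction_monomial]

variable (K m n t) in
/-- The monomial basis of `A(m,t) ⊗ A(t,n)`. -/
noncomputable def tensorWordBasis : Module.Basis
    ((Σ k, Word m k × Word t k) × (Σ k, Word t k × Word n k)) K
    (FreeAlgebra K (Fin m × Fin t) ⊗[K] FreeAlgebra K (Fin t × Fin n)) :=
  (wordBasis K m t).tensorProduct (wordBasis K t n)

theorem tensorWordBasis_apply {k l : ℕ} (I : Word m k) (J : Word t k) (P : Word t l)
    (Q : Word n l) :
    tensorWordBasis K m n t (⟨k, I, J⟩, ⟨l, P, Q⟩) =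
      monomialOfWords K I J ⊗ₜ[K] monomialOfWords K P Q := by
  simp [tensorWordBasis]

theorem repr_monomial_tmul_monomial {k l : ℕ} (I : Word m k) (J : Word t k) (P : Word t l)
    (Q : Word n l) :
    (tensorWordBasis K m n t).repr (monomialOfWords K I J ⊗ₜ[K] monomialOfWords K P Q) =
      Finsupp.single (⟨k, I, J⟩, ⟨l, P, Q⟩) 1 := by
  rw [← tensorWordBasis_apply, Module.Basis.repr_self]

theorem wordBasis_repr_monomial {k : ℕ} (I : Word m k) (J : Word n k) :
    (wordBasis K m n).repr (monomialOfWords K I J) = Finsupp.single ⟨k, I, J⟩ 1 := by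
  rw [← wordBasis_apply, Module.Basis.repr_self]

/-- The coordinates of `matrixComul a` at monomials of bidegree `(k, k)`. -/
theorem repr_matrixComul (a : FreeAlgebra K (Fin m × Fin n)) {k : ℕ} (I : Word m k)
    (J P : Word t k) (Q : Word n k) :
    (tensorWordBasis K m n t).repr (matrixComul K m n t a) (⟨k, I, J⟩, ⟨k, P, Q⟩) =
      if J = P then (wordBasis K m n).repr a ⟨k, I, Q⟩ else 0 := by
  classical
  have h : (tensorWordBasis K m n t).coord (⟨k, I, J⟩, ⟨k, P, Q⟩) ∘ₗ
      (matrixComul K m n t).toLinearMap =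
      if J = P then (wordBasis K m n).coord ⟨k, I, Q⟩ else 0 := by
    refine (wordBasis K m n).ext ?_
    rintro ⟨k', I', Q'⟩
    by_cases hk : k' = k
    · subst hk
      by_cases hJ : J = P
      · subst hJ
        by_cases hI : I' = I <;> by_cases hQ : Q' = Q <;>
          simp [matrixComul_monomial, repr_monomial_tmul_monomial, wordBasis_repr_monomial,
            Finsupp.single_apply, hI, hQ]
      · have hL (L : Word t k') : ¬ (L = J ∧ L = P) := fun h => hJ (h.1.symm.trans h.2)
        by_cases hI : I' = I <;> by_cases hQ : Q' = Q <;>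
          simp [matrixComul_monomial, repr_monomial_tmul_monomial, hI, hQ, hJ, hL]
    · split_ifs <;>
        simp [matrixComul_monomial, repr_monomial_tmul_monomial, wordBasis_repr_monomial, hk]
  have ha := LinearMap.congr_fun h a
  split_ifs at ha ⊢ <;> simpa using ha

/-- The coordinates of `matrixComul a` off the diagonal bidegrees vanish. -/
theorem repr_matrixComul_of_ne (a : FreeAlgebra K (Fin m × Fin n)) {k l : ℕ} (hkl : k ≠ l)
    (I : Word m k) (J : Word t k) (P : Word t l) (Q : Word n l) :
    (tensorWordBasis K m n t).repr (matrixComul K m n t a) (⟨k, I, J⟩, ⟨l, P, Q⟩) = 0 := by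
  have h : (tensorWordBasis K m n t).coord (⟨k, I, J⟩, ⟨l, P, Q⟩) ∘ₗ
      (matrixComul K m n t).toLinearMap = 0 := by
    refine (wordBasis K m n).ext ?_
    rintro ⟨k', I', Q'⟩
    simp only [LinearMap.comp_apply, AlgHom.toLinearMap_apply, wordBasis_apply,
      matrixComul_monomial, map_sum, Module.Basis.coord_apply, repr_monomial_tmul_monomial,
      LinearMap.zero_apply]
    refine Finset.sum_eq_zero fun L _ => Finsupp.single_eq_of_ne ?_
    intro h
    simp only [Prod.mk.injEq, Sigma.mk.injEq] at h
    exact hkl (h.1.1.trans h.2.1.symm)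
  exact LinearMap.congr_fun h a

theorem matrixComul_injective (ht : 0 < t) : Function.Injective (matrixComul K m n t) := by
  intro a b hab
  refine (wordBasis K m n).repr.injective (Finsupp.ext ?_)
  rintro ⟨k, I, Q⟩
  have h (a : FreeAlgebra K (Fin m × Fin n)) :=
    repr_matrixComul a I (Word.const (⟨0, ht⟩ : Fin t) k) (Word.const ⟨0, ht⟩ k) Q
  simp only [if_true] at h
  rw [← h a, ← h b, hab]

theorem balancedCoaction_matrixComul
    (hu_comul : ∀ i j, Coalgebra.comul (R := K) (u i j) = ∑ k : Fin t, u i k ⊗ₜ[K] u k j)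
    (hu_counit : ∀ i j, Coalgebra.counit (R := K) (u i j) = if i = j then (1 : K) else 0)
    (a : FreeAlgebra K (Fin m × Fin n)) :
    balancedCoaction K m n u (matrixComul K m n t a) = 1 ⊗ₜ[K] matrixComul K m n t a := by
  have h : balancedCoaction K m n u ∘ₗ (matrixComul K m n t).toLinearMap =
      TensorProduct.mk K H _ 1 ∘ₗ (matrixComul K m n t).toLinearMap := by
    refine (wordBasis K m n).ext ?_
    rintro ⟨k, I, Q⟩
    simp only [LinearMap.comp_apply, AlgHom.toLinearMap_apply, wordBasis_apply,
      matrixComul_monomial, map_sum, balancedCoaction_monomial, TensorProduct.mk_apply]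
    rw [Finset.sum_comm]
    refine Finset.sum_congr rfl fun L _ => ?_
    rw [Finset.sum_comm]
    simp only [← TensorProduct.sum_tmul, sum_antipode_mul_powCoeff hu_comul hu_counit]
    rw [Finset.sum_eq_single L (fun R _ hR => by rw [if_neg hR.symm, TensorProduct.zero_tmul])
      (by simp), if_pos rfl]
  exact LinearMap.congr_fun h a

/-- The slice of the coaction at a basis vector of `A(m,t) ⊗ A(t,n)`. -/
theorem rid_lTensor_coord_balancedCoaction
    (x : FreeAlgebra K (Fin m × Fin t) ⊗[K] FreeAlgebra K (Fin t × Fin n)) {k l : ℕ}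
    (I : Word m k) (L : Word t k) (R : Word t l) (Q : Word n l) :
    TensorProduct.rid K H (LinearMap.lTensor H
      ((tensorWordBasis K m n t).coord (⟨k, I, L⟩, ⟨l, R, Q⟩)) (balancedCoaction K m n u x)) =
      ∑ J, ∑ P, (tensorWordBasis K m n t).repr x (⟨k, I, J⟩, ⟨l, P, Q⟩) •
        (HopfAlgebra.antipode K (powCoeff u L J) * powCoeff u P R) := by
  classical
  have h : (TensorProduct.rid K H).toLinearMap ∘ₗ LinearMap.lTensor H
      ((tensorWordBasis K m n t).coord (⟨k, I, L⟩, ⟨l, R, Q⟩)) ∘ₗ balancedCoaction K m n u =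
      ∑ J, ∑ P, ((tensorWordBasis K m n t).coord (⟨k, I, J⟩, ⟨l, P, Q⟩)).smulRight
        (HopfAlgebra.antipode K (powCoeff u L J) * powCoeff u P R) := by
    refine (tensorWordBasis K m n t).ext ?_
    rintro ⟨⟨k', I', J'⟩, ⟨l', P', Q'⟩⟩
    simp only [LinearMap.comp_apply, tensorWordBasis_apply, balancedCoaction_monomial, map_sum,
      LinearMap.lTensor_tmul, LinearEquiv.coe_coe, TensorProduct.rid_tmul,
      Module.Basis.coord_apply, repr_monomial_tmul_monomial, LinearMap.sum_apply,
      LinearMap.smulRight_apply, Finsupp.single_apply, Prod.mk.injEq, Sigma.mk.injEq, ite_smul,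
      one_smul, zero_smul]
    by_cases hk : k' = k
    · subst hk
      by_cases hl : l' = l
      · subst hl
        by_cases hI : I' = I <;> by_cases hQ : Q' = Q <;> simp [hI, hQ, ite_and]
      · simp [hl]
    · simp [hk]
  simpa using LinearMap.congr_fun h x

/-- The coordinates of a coinvariant in a fixed bidegree form an intertwiner. -/
theorem intertwiner_of_coinvariant
    (hu_comul : ∀ i j, Coalgebra.comul (R := K) (u i j) = ∑ k : Fin t, u i k ⊗ₜ[K] u k j)
    (hu_counit : ∀ i j, Coalgebra.counit (R := K) (u i j) = if i = j then (1 : K) else 0)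
    {x : FreeAlgebra K (Fin m × Fin t) ⊗[K] FreeAlgebra K (Fin t × Fin n)}
    (hx : balancedCoaction K m n u x = 1 ⊗ₜ[K] x) {k l : ℕ} (I : Word m k) (Q : Word n l) :
    Comod.Hom ((matrixComod K H t u).pow k) ((matrixComod K H t u).pow l)
      (powMatrixMap u fun J P => (tensorWordBasis K m n t).repr x (⟨k, I, J⟩, ⟨l, P, Q⟩)) := by
  refine hom_powMatrixMap fun J R => ?_
  set c : Word t k → Word t l → K := fun J P =>
    (tensorWordBasis K m n t).repr x (⟨k, I, J⟩, ⟨l, P, Q⟩)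
  have hslice (L : Word t k) : ∑ J, ∑ P, c J P •
      (HopfAlgebra.antipode K (powCoeff u L J) * powCoeff u P R) = c L R • (1 : H) := by
    rw [← rid_lTensor_coord_balancedCoaction, hx]
    simp [c]
  have hmul : ∑ L, powCoeff u J L * ∑ J', ∑ P, c J' P •
      (HopfAlgebra.antipode K (powCoeff u L J') * powCoeff u P R) =
      ∑ L, c L R • powCoeff u J L := by
    simp [hslice]
  rw [← hmul]
  have hinv (J' : Word t k) (P : Word t l) : ∑ L, powCoeff u J L *
      (c J' P • (HopfAlgebra.antipode K (powCoeff u L J') * powCoeff u P R)) =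
      if J = J' then c J' P • powCoeff u P R else 0 := by
    simp only [mul_smul_comm, ← mul_assoc, ← Finset.smul_sum, ← Finset.sum_mul,
      sum_mul_antipode_powCoeff hu_comul hu_counit, ite_mul, one_mul, zero_mul, smul_ite,
      smul_zero]
  simp only [Finset.mul_sum]
  rw [Finset.sum_comm]
  simp_rw [Finset.sum_comm (s := (Finset.univ : Finset (Word t k)))
    (t := (Finset.univ : Finset (Word t l))), hinv]
  simp [c]

/-- A tensor whose coordinates define scalar intertwiners in equal degrees, and vanish in distinct
degrees, comes from `A(m,n)`. -/
theorem mem_range_matrixComul (ht : 0 < t)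
    {x : FreeAlgebra K (Fin m × Fin t) ⊗[K] FreeAlgebra K (Fin t × Fin n)}
    (hne : ∀ {k l : ℕ}, k ≠ l → ∀ (I : Word m k) (J : Word t k) (P : Word t l) (Q : Word n l),
      (tensorWordBasis K m n t).repr x (⟨k, I, J⟩, ⟨l, P, Q⟩) = 0)
    (hdiag : ∀ {k : ℕ} (I : Word m k) (Q : Word n k), ∃ d : K, ∀ J P : Word t k,
      (tensorWordBasis K m n t).repr x (⟨k, I, J⟩, ⟨k, P, Q⟩) = if J = P then d else 0) :
    x ∈ Set.range (matrixComul K m n t) := by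
  let J₀ (k : ℕ) : Word t k := Word.const ⟨0, ht⟩ k
  let e (w : Σ k, Word m k × Word n k) :
      (Σ k, Word m k × Word t k) × (Σ k, Word t k × Word n k) :=
    (⟨w.1, w.2.1, J₀ w.1⟩, ⟨w.1, J₀ w.1, w.2.2⟩)
  have he : Function.Injective e := by
    rintro ⟨k, I, Q⟩ ⟨k', I', Q'⟩ h
    simp only [e, Prod.mk.injEq, Sigma.mk.injEq] at h
    obtain ⟨⟨rfl, h₁⟩, -, h₂⟩ := h
    simp only [heq_eq_eq, Prod.mk.injEq, and_true, true_and] at h₁ h₂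
    rw [h₁, h₂]
  let a := (wordBasis K m n).repr.symm
    (Finsupp.comapDomain e ((tensorWordBasis K m n t).repr x) he.injOn)
  refine ⟨a, (tensorWordBasis K m n t).repr.injective (Finsupp.ext ?_)⟩
  rintro ⟨⟨k, I, J⟩, ⟨l, P, Q⟩⟩
  by_cases hkl : k = l
  · subst hkl
    obtain ⟨d, hd⟩ := hdiag I Q
    have ha : (wordBasis K m n).repr a ⟨k, I, Q⟩ = d := by
      simp [a, e, hd]
    rw [repr_matrixComul, ha, hd]
  · rw [repr_matrixComul_of_ne a hkl, hne hkl]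

end Coinvariants

/-- **Theorem 2.1 (free quantum first fundamental theorem, abstract form).**
Let `u ∈ M_t(H)` be a multiplicative matrix of a Hopf algebra `H` whose associated left
comodule `U_l = K^t` has simple, pairwise non-isomorphic tensor powers `U_l^{⊗k}` (`k ≥ 1`)
with endomorphism algebras reduced to the scalars (as is the case for the universal
cosovereign Hopf algebras `H(F)`). Endow `A(m,t)` with the right `H`-comodule algebra
structure `ρ(y_{ij}) = ∑ₖ y_{ik} ⊗ u_{kj}` and `A(t,n)` with the left `H`-comodule algebra
structure `λ(z_{ij}) = ∑ₖ u_{ik} ⊗ z_{kj}`. Then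
`θ : A(m,n) → A(m,t) ⊗ A(t,n)`, `θ(x_{ij}) = ∑ₖ y_{ik} ⊗ z_{kj}`, is injective with image
exactly the coinvariants `(A(m,t) ⊗ A(t,n))^{co H}`, hence induces an algebra isomorphism
`A(m,n) ≅ (A(m,t) ⊗ A(t,n))^{co H}`. -/
theorem free_quantum_first_fundamental_theorem
    (m n t : ℕ) (hm : 0 < m) (hn : 0 < n) (ht : 0 < t)
    (u : Matrix (Fin t) (Fin t) H)
    (hu_comul : ∀ i j, Coalgebra.comul (R := K) (u i j) = ∑ k : Fin t, u i k ⊗ₜ[K] u k j)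
    (hu_counit : ∀ i j, Coalgebra.counit (R := K) (u i j) = if i = j then (1 : K) else 0)
    (hsimple : ∀ k : ℕ, 1 ≤ k → ((matrixComod K H t u).pow k).IsSimple)
    (hend : ∀ k : ℕ, 1 ≤ k →
      ∀ f : ((matrixComod K H t u).pow k).carrier →ₗ[K] ((matrixComod K H t u).pow k).carrier,
        Comod.Hom ((matrixComod K H t u).pow k) ((matrixComod K H t u).pow k) f →
          ∃ c : K, f = c • LinearMap.id)
    (hniso : ∀ k l : ℕ, 1 ≤ k → 1 ≤ l → k ≠ l →
      ¬∃ f : ((matrixComod K H t u).pow k).carrier →ₗ[K] ((matrixComod K H t u).pow l).carrier,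
        Comod.Hom ((matrixComod K H t u).pow k) ((matrixComod K H t u).pow l) f ∧
          Function.Bijective f) :
    letI ρ : FreeAlgebra K (Fin m × Fin t) →ₐ[K] FreeAlgebra K (Fin m × Fin t) ⊗[K] H :=
      FreeAlgebra.lift K fun p : Fin m × Fin t =>
        ∑ k : Fin t, FreeAlgebra.ι K ((p.1, k) : Fin m × Fin t) ⊗ₜ[K] u k p.2
    letI lam : FreeAlgebra K (Fin t × Fin n) →ₐ[K] H ⊗[K] FreeAlgebra K (Fin t × Fin n) :=
      FreeAlgebra.lift K fun p : Fin t × Fin n =>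
        ∑ k : Fin t, u p.1 k ⊗ₜ[K] FreeAlgebra.ι K ((k, p.2) : Fin t × Fin n)
    letI θ : FreeAlgebra K (Fin m × Fin n) →ₐ[K]
        FreeAlgebra K (Fin m × Fin t) ⊗[K] FreeAlgebra K (Fin t × Fin n) :=
      FreeAlgebra.lift K fun p : Fin m × Fin n =>
        ∑ k : Fin t,
          FreeAlgebra.ι K ((p.1, k) : Fin m × Fin t) ⊗ₜ[K] FreeAlgebra.ι K ((k, p.2) : Fin t × Fin n)
    Function.Injective θ ∧
      Set.range θ =
        coinvariants K H
          (tensorCoaction K H (leftCoactionOfRight K H ρ.toLinearMap) lam.toLinearMap) := by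
  refine ⟨matrixComul_injective ht, Set.Subset.antisymm ?_ fun x hx => ?_⟩
  · rintro _ ⟨a, rfl⟩
    exact balancedCoaction_matrixComul hu_comul hu_counit a
  · have hom {k l : ℕ} (I : Word m k) (Q : Word n l) :=
      intertwiner_of_coinvariant hu_comul hu_counit hx I Q
    refine mem_range_matrixComul ht (fun hkl I J P Q => ?_) fun I Q => ?_
    · have h0 := (hom I Q).pow_eq_zero hsimple hniso hkl
      rw [← repr_powMatrixMap (u := u)
        (fun J P => (tensorWordBasis K m n t).repr x (⟨_, I, J⟩, ⟨_, P, Q⟩)) J P, h0]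
      simp
    · obtain ⟨d, hd⟩ := (hom I Q).pow_eq_smul_id hend
      refine ⟨d, fun J P => ?_⟩
      rw [← repr_powMatrixMap (u := u)
        (fun J P => (tensorWordBasis K m n t).repr x (⟨_, I, J⟩, ⟨_, P, Q⟩)) J P, hd]
      simp [Finsupp.single_apply]
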